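/- Marstrand-type projection theorem for macroscopic dimension: Let E ⊂ ℝ² be a Borel set, and for θ ∈ [0,π] let proj_θ E denote the orthogonal projection of E onto the line through 0 with angle θ. If Dim_H(E) < 1, then Dim_H(proj_θ E) = Dim_H(E) for Lebesgue-almost every θ ∈ [0,π]; if Dim_H(E) ≥ 1, then Dim_H(proj_θ E) = 1 for Lebesgue-almost every θ ∈ [0,π]. -/

import Mathlib

open Metric Set ENNReal MeasureTheory

noncomputable def shell (X : Type*) [NormedAddCommGroup X] (n : ℕ) : Set X :=
  if n = 0 then Metric.ball 0 1 else Metric.ball 0 ((2:ℝ)^n) \ Metric.ball 0 ((2:ℝ)^(n-1))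

noncomputable def nuT {X : Type*} [NormedAddCommGroup X] (s : ℝ) (n : ℕ) (E : Set X) : ℝ≥0∞ :=
  sInf { t : ℝ≥0∞ | ∃ (m : ℕ) (x : Fin m → X) (r : Fin m → ℝ),
    (∀ i, x i ∈ shell X n) ∧ (∀ i, 1 ≤ r i) ∧
    (E ∩ shell X n ⊆ ⋃ i, Metric.ball (x i) (r i)) ∧
    t = ∑ i, ENNReal.ofReal ((r i / 2^n)^s) }

noncomputable def macroDim {X : Type*} [NormedAddCommGroup X] (E : Set X) : ℝ :=
  sInf { s : ℝ | 0 ≤ s ∧ ∑' n, nuT s n E < ⊤ }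

def IsIntegerPoint {d : ℕ} (x : EuclideanSpace ℝ (Fin d)) : Prop := ∀ j, ∃ z : ℤ, x j = (z : ℝ)

def IsProperCover {d : ℕ} (n : ℕ) (E : Set (EuclideanSpace ℝ (Fin d))) {m : ℕ}
    (x : Fin m → EuclideanSpace ℝ (Fin d)) (r : Fin m → ℕ) : Prop :=
  (∀ i, x i ∈ shell (EuclideanSpace ℝ (Fin d)) n) ∧ (∀ i, IsIntegerPoint (x i)) ∧
  (∀ i, 1 ≤ r i) ∧ (E ∩ shell (EuclideanSpace ℝ (Fin d)) n ⊆ ⋃ i, Metric.ball (x i) ((r i : ℝ)))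

noncomputable def nuP {d : ℕ} (s : ℝ) (n : ℕ) (E : Set (EuclideanSpace ℝ (Fin d))) : ℝ≥0∞ :=
  sInf { t : ℝ≥0∞ | ∃ (m : ℕ) (x : Fin m → EuclideanSpace ℝ (Fin d)) (r : Fin m → ℕ),
    IsProperCover n E x r ∧ t = ∑ i, ENNReal.ofReal (((r i : ℝ) / 2^n)^s) }

open RealInnerProductSpace in
/-- The unit vector with angle `θ`. -/
noncomputable def eVec (θ : ℝ) : EuclideanSpace ℝ (Fin 2) :=
  (EuclideanSpace.equiv (Fin 2) ℝ).symm ![Real.cos θ, Real.sin θ]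

open RealInnerProductSpace in
/-- Orthogonal projection onto the line `L_θ` through the origin with angle `θ`. -/
noncomputable def projLine (θ : ℝ) (x : EuclideanSpace ℝ (Fin 2)) :
    EuclideanSpace ℝ (Fin 2) :=
  ⟪x, eVec θ⟫ • eVec θ

/-- The `n`-th shell `S_n^θ = {v ∈ L_θ : ‖v‖ ∈ [2^{n-1}, 2^n]}` inside the line `L_θ`. -/
noncomputable def shellLine (θ : ℝ) (n : ℕ) : Set (EuclideanSpace ℝ (Fin 2)) :=
  { v | (∃ t : ℝ, v = t • eVec θ) ∧ ‖v‖ ∈ Set.Icc ((2:ℝ)^n / 2) ((2:ℝ)^n) }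

section Shells

variable {X : Type*} [NormedAddCommGroup X]

theorem norm_lt_of_mem_shell {n : ℕ} {x : X} (hx : x ∈ shell X n) : ‖x‖ < 2 ^ n := by
  unfold shell at hx
  split_ifs at hx with h
  · simpa [h] using hx
  · simpa using hx.1

theorem half_le_norm_of_mem_shell {n : ℕ} (hn : n ≠ 0) {x : X} (hx : x ∈ shell X n) :
    (2 : ℝ) ^ n / 2 ≤ ‖x‖ := by
  obtain ⟨k, rfl⟩ := Nat.exists_eq_succ_of_ne_zero hn
  simp only [shell, if_neg hn] at hx
  have h := hx.2
  simp only [Nat.succ_eq_add_one, Nat.add_sub_cancel, mem_ball, dist_zero_right, not_lt] at h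
  rw [Nat.succ_eq_add_one, pow_succ]
  linarith

theorem exists_mem_shell (x : X) : ∃ n, x ∈ shell X n := by
  classical
  have h : ∃ n : ℕ, ‖x‖ < 2 ^ n := pow_unbounded_of_one_lt _ one_lt_two
  refine ⟨Nat.find h, ?_⟩
  have h1 := Nat.find_spec h
  unfold shell
  split_ifs with h0
  · simpa [h0] using h1
  · refine ⟨by simpa using h1, ?_⟩
    have h2 := Nat.find_min h (Nat.sub_one_lt h0)
    simpa using h2

theorem dist_lt_of_mem_shell {n : ℕ} {x y : X} (hx : x ∈ shell X n) (hy : y ∈ shell X n) :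
    dist x y < 2 * 2 ^ n := by
  have := dist_le_norm_add_norm x y
  linarith [norm_lt_of_mem_shell hx, norm_lt_of_mem_shell hy]

/-- Covers with arbitrary centres bound `nuT`, at the price of doubling the radii. -/
theorem nuT_le_sum {ι : Type*} {s : ℝ} {n : ℕ} {E : Set X} (S : Finset ι)
    (x : ι → X) (r : ι → ℝ) (hr : ∀ i ∈ S, 1 ≤ r i)
    (hc : E ∩ shell X n ⊆ ⋃ i ∈ S, ball (x i) (r i)) :
    nuT s n E ≤ ∑ i ∈ S, ENNReal.ofReal ((2 * r i / 2 ^ n) ^ s) := by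
  classical
  set S' := S.filter (fun i => (ball (x i) (r i) ∩ shell X n).Nonempty) with hS'
  have hne : ∀ i : S', (ball (x i) (r i) ∩ shell X n).Nonempty := fun i =>
    (Finset.mem_filter.1 i.2).2
  have hmem : ∀ i : S', (i : ι) ∈ S := fun i => (Finset.mem_filter.1 i.2).1
  choose c hcb hcs using hne
  have e := S'.equivFin
  have key : nuT s n E ≤ ∑ i ∈ S', ENNReal.ofReal ((2 * r i / 2 ^ n) ^ s) := by
    unfold nuT
    refine sInf_le ⟨S'.card, fun a => c (e.symm a), fun a => 2 * r (e.symm a : ι),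
      fun a => hcs _, fun a => ?_, ?_, ?_⟩
    · linarith [hr _ (hmem (e.symm a))]
    · intro y hy
      obtain ⟨i, hi, hyi⟩ := mem_iUnion₂.1 (hc hy)
      have hi' : i ∈ S' := Finset.mem_filter.2 ⟨hi, ⟨y, hyi, hy.2⟩⟩
      refine mem_iUnion.2 ⟨e ⟨i, hi'⟩, ?_⟩
      have h1 := hcb ⟨i, hi'⟩
      simp only [Equiv.symm_apply_apply, mem_ball] at h1 hyi ⊢
      have := dist_triangle_right y (c ⟨i, hi'⟩) (x i)
      linarith
    · rw [Equiv.sum_comp e.symm (fun i : S' => ENNReal.ofReal ((2 * r i / 2 ^ n) ^ s)),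
        Finset.sum_coe_sort S' (fun i => ENNReal.ofReal ((2 * r i / 2 ^ n) ^ s))]
  exact key.trans (Finset.sum_le_sum_of_subset (Finset.filter_subset _ _))

theorem nuT_lt_top (s : ℝ) (n : ℕ) (E : Set X) : nuT s n E < ⊤ := by
  refine (nuT_le_sum (Finset.univ : Finset Unit) (fun _ => 0) (fun _ => 2 ^ n)
    (fun _ _ => one_le_pow₀ one_le_two) ?_).trans_lt (by simp)
  intro y hy
  simpa using norm_lt_of_mem_shell hy.2

theorem nuT_le_mul_nuT {s s' : ℝ} (h : s ≤ s') (h0 : 0 ≤ s) (n : ℕ) (E : Set X) :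
    nuT s' n E ≤ ENNReal.ofReal (4 ^ s') * nuT s n E := by
  have h4 : (0 : ℝ) < 4 ^ s' := by positivity
  rw [mul_comm, ← ENNReal.div_le_iff (by simpa using h4) (by simp)]
  refine le_sInf ?_
  rintro t ⟨m, x, r, hx, hr, hc, rfl⟩
  rw [ENNReal.div_le_iff (by simpa using h4) (by simp), Finset.sum_mul]
  refine (nuT_le_sum Finset.univ x (fun i => min (r i) (2 * 2 ^ n)) ?_ ?_).trans ?_
  · intro i _
    have : (1 : ℝ) ≤ 2 ^ n := one_le_pow₀ one_le_two
    exact le_min (hr i) (by linarith)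
  · intro y hy
    obtain ⟨i, hi⟩ := mem_iUnion.1 (hc hy)
    refine mem_iUnion₂.2 ⟨i, Finset.mem_univ _, ?_⟩
    exact lt_min hi (dist_lt_of_mem_shell hy.2 (hx i))
  · refine Finset.sum_le_sum fun i _ => ?_
    have hri := hr i
    have h2 : (0 : ℝ) < 2 ^ n := by positivity
    rw [← ENNReal.ofReal_mul (by positivity)]
    refine ENNReal.ofReal_le_ofReal ?_
    set v := min (r i) (2 * 2 ^ n) / 2 ^ n with hv
    have hv0 : 0 < v := div_pos (lt_min (by linarith) (by positivity)) h2
    have hv2 : v ≤ 2 := by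
      rw [hv, div_le_iff₀ h2]; exact min_le_right _ _
    have hvr : v ≤ r i / 2 ^ n := by
      rw [hv]; gcongr; exact min_le_left _ _
    have e1 : 2 * min (r i) (2 * 2 ^ n) / 2 ^ n = 2 * v := by rw [hv]; ring
    rw [e1, Real.mul_rpow (by norm_num) hv0.le]
    have e2 : v ^ s' = v ^ s * v ^ (s' - s) := by rw [← Real.rpow_add hv0]; congr 1; ring
    have e3 : v ^ (s' - s) ≤ 2 ^ s' :=
      (Real.rpow_le_rpow hv0.le hv2 (by linarith)).trans
        (Real.rpow_le_rpow_of_exponent_le one_le_two (by linarith))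
    have e4 : v ^ s ≤ (r i / 2 ^ n) ^ s := Real.rpow_le_rpow hv0.le hvr h0
    have e5 : (4 : ℝ) ^ s' = 2 ^ s' * 2 ^ s' := by
      rw [← Real.mul_rpow (by norm_num) (by norm_num)]; norm_num
    rw [e2, e5]
    have : 0 ≤ v ^ s := by positivity
    have h2s : (0 : ℝ) ≤ 2 ^ s' := by positivity
    calc 2 ^ s' * (v ^ s * v ^ (s' - s)) ≤ 2 ^ s' * ((r i / 2 ^ n) ^ s * 2 ^ s') := by gcongr
      _ = _ := by ring

theorem tsum_nuT_lt_top_of_le {s s' : ℝ} (h : s ≤ s') (h0 : 0 ≤ s) {E : Set X}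
    (hE : ∑' n, nuT s n E < ⊤) : ∑' n, nuT s' n E < ⊤ := by
  refine (ENNReal.tsum_le_tsum fun n => nuT_le_mul_nuT h h0 n E).trans_lt ?_
  rw [ENNReal.tsum_mul_left]
  exact ENNReal.mul_lt_top (by simp) hE

theorem macroDim_nonneg (E : Set X) : 0 ≤ macroDim E :=
  Real.sInf_nonneg fun _ h => h.1

theorem macroDim_le {s : ℝ} (h0 : 0 ≤ s) {E : Set X} (h : ∑' n, nuT s n E < ⊤) :
    macroDim E ≤ s :=
  csInf_le ⟨0, fun _ h => h.1⟩ ⟨h0, h⟩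

theorem tsum_nuT_eq_top_of_lt {s : ℝ} (h0 : 0 ≤ s) {E : Set X} (h : s < macroDim E) :
    ∑' n, nuT s n E = ⊤ := by
  by_contra hne
  exact absurd (macroDim_le h0 (lt_top_iff_ne_top.2 hne)) (not_le.2 h)

theorem le_macroDim {s s' : ℝ} {E : Set X} (h' : 0 ≤ s' ∧ ∑' n, nuT s' n E < ⊤)
    (h : ∑' n, nuT s n E = ⊤) : s ≤ macroDim E := by
  refine le_csInf ⟨s', h'⟩ fun u hu => ?_
  by_contra! hlt
  exact (tsum_nuT_lt_top_of_le hlt.le hu.1 hu.2).ne h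

theorem tsum_nuT_lt_top_of_macroDim_lt {s s' : ℝ} {E : Set X}
    (h' : 0 ≤ s' ∧ ∑' n, nuT s' n E < ⊤) (h : macroDim E < s) : ∑' n, nuT s n E < ⊤ := by
  obtain ⟨u, hu, hus⟩ := exists_lt_of_csInf_lt ⟨s', h'⟩ h
  exact tsum_nuT_lt_top_of_le hus.le hu.1 hu.2

/-- If the `n`-th ball of radius `2 ^ n` is covered by `C * 2 ^ (d * n)` balls of radius `2`, the
series defining the dimension converges for all exponents above `d`. -/
theorem tsum_nuT_lt_top_of_card_le {C d s : ℝ} (hs : d < s) (S : ℕ → Finset X)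
    (hcard : ∀ n, ((S n).card : ℝ) ≤ C * (2 ^ n) ^ d)
    (hcov : ∀ n, ∀ y : X, ‖y‖ < 2 ^ n → ∃ x ∈ S n, dist y x < 2) (E : Set X) :
    ∑' n, nuT s n E < ⊤ := by
  have hq : (2 : ℝ) ^ (d - s) < 1 := Real.rpow_lt_one_of_one_lt_of_neg one_lt_two (by linarith)
  have hsum : Summable fun n : ℕ => C * 4 ^ s * ((2 : ℝ) ^ (d - s)) ^ n :=
    (summable_geometric_of_lt_one (by positivity) hq).mul_left _
  refine (ENNReal.tsum_le_tsum fun n => ?_).trans_lt hsum.tsum_ofReal_lt_top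
  refine (nuT_le_sum (S n) id (fun _ => 2) (fun _ _ => one_le_two) fun y hy => ?_).trans ?_
  · obtain ⟨x, hx, hxy⟩ := hcov n y (norm_lt_of_mem_shell hy.2)
    exact mem_iUnion₂.2 ⟨x, hx, hxy⟩
  · rw [Finset.sum_const, nsmul_eq_mul, ← ENNReal.ofReal_natCast,
      ← ENNReal.ofReal_mul (by positivity)]
    refine ENNReal.ofReal_le_ofReal ?_
    have e : (2 * 2 / 2 ^ n : ℝ) ^ s = 4 ^ s * ((2 ^ n) ^ s)⁻¹ := by
      rw [Real.div_rpow (by norm_num) (by positivity), div_eq_mul_inv]; norm_num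
    have e2 : ((2 : ℝ) ^ (d - s)) ^ n = (2 ^ n) ^ d * ((2 ^ n) ^ s)⁻¹ := by
      rw [← Real.rpow_natCast, ← Real.rpow_mul (by norm_num), mul_comm, Real.rpow_mul (by norm_num),
        Real.rpow_natCast, Real.rpow_sub (by positivity), div_eq_mul_inv]
    rw [e, e2]
    calc ((S n).card : ℝ) * (4 ^ s * ((2 ^ n) ^ s)⁻¹)
        ≤ (C * (2 ^ n) ^ d) * (4 ^ s * ((2 ^ n) ^ s)⁻¹) := by gcongr; exact hcard n
      _ = _ := by ring

end Shells

theorem card_Icc_two_pow (n : ℕ) : ((Finset.Icc (-2 ^ n : ℤ) (2 ^ n)).card : ℝ) ≤ 3 * 2 ^ n := by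
  have h1 : (1 : ℝ) ≤ 2 ^ n := one_le_pow₀ one_le_two
  have h3 : (0 : ℤ) ≤ 2 ^ n + 1 - -2 ^ n := by
    have : (0 : ℤ) < 2 ^ n := by positivity
    linarith
  have h2 : ((Finset.Icc (-2 ^ n : ℤ) (2 ^ n)).card : ℝ) = 2 * 2 ^ n + 1 := by
    rw [Int.card_Icc, ← Int.cast_natCast, Int.toNat_of_nonneg h3]
    push_cast; ring
  linarith

theorem floor_mem_Icc_two_pow {n : ℕ} {y : ℝ} (hy : |y| < 2 ^ n) :
    ⌊y⌋ ∈ Finset.Icc (-2 ^ n : ℤ) (2 ^ n) := by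
  have h := abs_lt.1 hy
  refine Finset.mem_Icc.2 ⟨Int.le_floor.2 (by push_cast; exact h.1.le), ?_⟩
  have : (⌊y⌋ : ℝ) ≤ ((2 ^ n : ℤ) : ℝ) := by
    push_cast
    exact (Int.floor_le y).trans h.2.le
  exact_mod_cast this

theorem tsum_nuT_real_lt_top {s : ℝ} (hs : 1 < s) (E : Set ℝ) : ∑' n, nuT s n E < ⊤ := by
  classical
  refine tsum_nuT_lt_top_of_card_le (C := 3) hs
    (fun n => (Finset.Icc (-2 ^ n : ℤ) (2 ^ n)).image (fun k : ℤ => (k : ℝ))) (fun n => ?_)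
    (fun n y hy => ?_) E
  · rw [Real.rpow_one]
    exact (Nat.cast_le.2 Finset.card_image_le).trans (card_Icc_two_pow n)
  · refine ⟨(⌊y⌋ : ℝ), Finset.mem_image_of_mem _ (floor_mem_Icc_two_pow hy), ?_⟩
    rw [Real.dist_eq, abs_lt]
    constructor <;> linarith [Int.floor_le y, Int.lt_floor_add_one y]

theorem tsum_nuT_plane_lt_top {s : ℝ} (hs : 2 < s) (E : Set (EuclideanSpace ℝ (Fin 2))) :
    ∑' n, nuT s n E < ⊤ := by
  classical
  let f : ℤ × ℤ → EuclideanSpace ℝ (Fin 2) := fun k => !₂[(k.1 : ℝ), (k.2 : ℝ)]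
  refine tsum_nuT_lt_top_of_card_le (C := 9) hs
    (fun n => (Finset.Icc (-2 ^ n : ℤ) (2 ^ n) ×ˢ Finset.Icc (-2 ^ n : ℤ) (2 ^ n)).image f)
    (fun n => ?_) (fun n y hy => ?_) E
  · refine (Nat.cast_le.2 Finset.card_image_le).trans ?_
    rw [Real.rpow_two, Finset.card_product, Nat.cast_mul]
    have := card_Icc_two_pow n
    nlinarith [Nat.cast_nonneg (α := ℝ) (Finset.Icc (-2 ^ n : ℤ) (2 ^ n)).card]
  · have hmem : ∀ i, ⌊y i⌋ ∈ Finset.Icc (-2 ^ n : ℤ) (2 ^ n) := fun i =>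
      floor_mem_Icc_two_pow ((PiLp.norm_apply_le y i).trans_lt hy)
    refine ⟨f (⌊y 0⌋, ⌊y 1⌋),
      Finset.mem_image_of_mem _ (Finset.mk_mem_product (hmem 0) (hmem 1)), ?_⟩
    rw [EuclideanSpace.dist_eq, Real.sqrt_lt' (by norm_num)]
    simp only [f, Fin.sum_univ_two, Real.dist_eq, sq_abs]
    simp only [Matrix.cons_val_zero, Matrix.cons_val_one]
    nlinarith [Int.floor_le (y 0), Int.lt_floor_add_one (y 0), Int.floor_le (y 1),
      Int.lt_floor_add_one (y 1)]

theorem inner_eVec (x : EuclideanSpace ℝ (Fin 2)) (θ : ℝ) :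
    inner ℝ x (eVec θ) = x 0 * Real.cos θ + x 1 * Real.sin θ := by
  simp [eVec, PiLp.inner_apply, Fin.sum_univ_two, mul_comm]

theorem continuous_inner_eVec (x : EuclideanSpace ℝ (Fin 2)) :
    Continuous fun θ => inner ℝ x (eVec θ) := by
  simp only [inner_eVec]
  fun_prop

theorem norm_eVec (θ : ℝ) : ‖eVec θ‖ = 1 := by
  simp [eVec, EuclideanSpace.norm_eq, Fin.sum_univ_two]

theorem abs_inner_eVec_le (x : EuclideanSpace ℝ (Fin 2)) (θ : ℝ) :
    |inner ℝ x (eVec θ)| ≤ ‖x‖ := by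
  simpa [norm_eVec] using abs_real_inner_le_norm x (eVec θ)

theorem abs_inner_eVec_sub_le (x y : EuclideanSpace ℝ (Fin 2)) (θ : ℝ) :
    |inner ℝ x (eVec θ) - inner ℝ y (eVec θ)| ≤ dist x y := by
  rw [← inner_sub_left, dist_eq_norm]
  exact abs_inner_eVec_le _ _

theorem exists_inner_eVec_eq_cos (z : EuclideanSpace ℝ (Fin 2)) :
    ∃ α, |α| ≤ Real.pi ∧ ∀ θ, inner ℝ z (eVec θ) = ‖z‖ * Real.cos (θ - α) := by
  set c : ℂ := ⟨z 0, z 1⟩ with hc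
  have hn : ‖z‖ = ‖c‖ := by
    rw [EuclideanSpace.norm_eq, Complex.norm_eq_sqrt_sq_add_sq]
    simp [Fin.sum_univ_two, hc]
  refine ⟨c.arg, Complex.abs_arg_le_pi c, fun θ => ?_⟩
  have h1 := Complex.norm_mul_cos_arg c
  have h2 := Complex.norm_mul_sin_arg c
  rw [inner_eVec, hn, Real.cos_sub]
  simp only [hc] at h1 h2 ⊢
  linear_combination (-Real.cos θ) * h1 - Real.sin θ * h2

/-- The measure on angles used in Marstrand's theorem. -/
noncomputable abbrev angleMeasure : Measure ℝ := volume.restrict (Icc 0 Real.pi)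

theorem angleMeasure_le (A : Set ℝ) : angleMeasure A ≤ ENNReal.ofReal 4 := by
  refine (measure_mono (subset_univ A)).trans ?_
  rw [Measure.restrict_apply_univ, Real.volume_Icc]
  exact ENNReal.ofReal_le_ofReal (by linarith [Real.pi_le_four])

theorem angleMeasure_abs_inner_le {z : EuclideanSpace ℝ (Fin 2)} (hz : 0 < ‖z‖) {u : ℝ}
    (hu : 0 ≤ u) :
    angleMeasure {θ | |inner ℝ z (eVec θ)| ≤ u} ≤ ENNReal.ofReal (20 * u / ‖z‖) := by
  obtain ⟨α, hα, h⟩ := exists_inner_eVec_eq_cos z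
  have hpi := Real.pi_pos
  set v := u / ‖z‖ with hv
  have hv0 : 0 ≤ v := by positivity
  let c : ℤ → ℝ := fun k => α + Real.pi / 2 + k * Real.pi
  have hsub : {θ | |inner ℝ z (eVec θ)| ≤ u} ∩ Icc 0 Real.pi ⊆
      ⋃ k ∈ Finset.Icc (-2 : ℤ) 2, Icc (c k - 2 * v) (c k + 2 * v) := by
    rintro θ ⟨hθ, hθ0, hθ1⟩
    set k := round ((θ - α - Real.pi / 2) / Real.pi) with hk
    set ψ := θ - c k with hψ
    have hr := abs_sub_round ((θ - α - Real.pi / 2) / Real.pi)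
    rw [← hk] at hr
    have hψ2 : ψ = ((θ - α - Real.pi / 2) / Real.pi - k) * Real.pi := by
      simp only [hψ, c]; field_simp; ring
    have hψ3 : |ψ| ≤ Real.pi / 2 := by
      rw [hψ2, abs_mul, abs_of_pos hpi]
      nlinarith
    have hcos : |Real.cos (θ - α)| = |Real.sin ψ| := by
      have : θ - α = ψ + k * Real.pi + Real.pi / 2 := by simp only [hψ, c]; ring
      rw [this, Real.cos_add_pi_div_two, abs_neg, Real.sin_add_int_mul_pi, abs_mul]
      simp
    have hsv : |Real.sin ψ| ≤ v := by
      have h1 : |inner ℝ z (eVec θ)| ≤ u := hθ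
      rw [h θ, abs_mul, abs_norm, hcos] at h1
      rw [hv, le_div_iff₀ hz]
      linarith
    have hψv : |ψ| ≤ 2 * v := by
      have h1 := Real.mul_abs_le_abs_sin hψ3
      have h2 : 1 / 2 ≤ 2 / Real.pi := by
        rw [div_le_div_iff₀ (by norm_num) hpi]; linarith [Real.pi_le_four]
      nlinarith [abs_nonneg ψ]
    have hψ4 := abs_le.1 hψ3
    have hα' := abs_le.1 hα
    refine mem_iUnion₂.2 ⟨k, ?_, ?_⟩
    · simp only [hψ, c] at hψ4
      have k1 : (-3 : ℝ) < k := by nlinarith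
      have k2 : (k : ℝ) < 3 := by nlinarith
      have k1' : -3 < k := by exact_mod_cast k1
      have k2' : k < 3 := by exact_mod_cast k2
      exact Finset.mem_Icc.2 ⟨by omega, by omega⟩
    · have := abs_le.1 hψv
      constructor <;> linarith
  rw [Measure.restrict_apply' measurableSet_Icc]
  refine (measure_mono hsub).trans ((measure_biUnion_finset_le _ _).trans ?_)
  simp only [Real.volume_Icc]
  rw [Finset.sum_congr rfl (fun k _ => by
    rw [show c k + 2 * v - (c k - 2 * v) = 4 * v by ring])]
  rw [Finset.sum_const, nsmul_eq_mul, ← ENNReal.ofReal_natCast,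
    ← ENNReal.ofReal_mul (by positivity)]
  refine ENNReal.ofReal_le_ofReal (le_of_eq ?_)
  simp [hv]
  ring

theorem angleMeasure_abs_inner_le_of_mem_shell {n : ℕ} {x : EuclideanSpace ℝ (Fin 2)}
    (hx : x ∈ shell _ n) {u : ℝ} (hu : 0 ≤ u) (h : n ≠ 0 ∨ 1 ≤ u) :
    angleMeasure {θ | |inner ℝ x (eVec θ)| ≤ u} ≤ ENNReal.ofReal (40 * (u / 2 ^ n)) := by
  by_cases hn : n = 0
  · refine (angleMeasure_le _).trans (ENNReal.ofReal_le_ofReal ?_)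
    have : 1 ≤ u := h.resolve_left (not_not.2 hn)
    simp [hn]; linarith
  · have h1 := half_le_norm_of_mem_shell hn hx
    have h2 : (0 : ℝ) < 2 ^ n / 2 := by positivity
    refine (angleMeasure_abs_inner_le (h2.trans_le h1) hu).trans (ENNReal.ofReal_le_ofReal ?_)
    calc 20 * u / ‖x‖ ≤ 20 * u / (2 ^ n / 2) := by gcongr
      _ = _ := by field_simp; ring

/-- Geometric sums over dyadic scales are bounded uniformly in the top scale. -/
theorem exists_sum_dyadic_le {ε : ℝ} (hε : 0 < ε) :
    ∃ C : ℝ, 1 ≤ C ∧ ∀ n : ℕ, ∑ j ∈ Finset.range (n + 1), ((2 : ℝ) ^ j / 2 ^ n) ^ ε ≤ C := by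
  set q : ℝ := (1 / 2) ^ ε with hq
  have hq0 : 0 < q := by positivity
  have hq1 : q < 1 := Real.rpow_lt_one (by norm_num) (by norm_num) hε
  have h1q : 0 < 1 - q := by linarith
  refine ⟨1 / (1 - q), by rw [le_div_iff₀ h1q]; linarith, fun n => ?_⟩
  induction n with
  | zero => simp; exact (one_le_inv₀ h1q).2 (by linarith)
  | succ n ih =>
    rw [Finset.sum_range_succ]
    have : ∀ j ∈ Finset.range (n + 1),
        ((2 : ℝ) ^ j / 2 ^ (n + 1)) ^ ε = q * ((2 : ℝ) ^ j / 2 ^ n) ^ ε := fun j _ => by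
      rw [hq, ← Real.mul_rpow (by norm_num) (by positivity)]
      congr 1
      field_simp
      ring
    rw [Finset.sum_congr rfl this, ← Finset.mul_sum, div_self (by positivity), Real.one_rpow]
    calc q * _ + 1 ≤ q * (1 / (1 - q)) + 1 := by gcongr
      _ = _ := by field_simp; ring

/-- A cover whose cost is close to `nuT`. -/
theorem exists_cover_le {X : Type*} [NormedAddCommGroup X] (s : ℝ) (n : ℕ) (E : Set X) {ε : ℝ≥0∞}
    (hε : ε ≠ 0) :
    ∃ (m : ℕ) (x : Fin m → X) (r : Fin m → ℝ),
      (∀ i, x i ∈ shell X n) ∧ (∀ i, 1 ≤ r i) ∧ (E ∩ shell X n ⊆ ⋃ i, ball (x i) (r i)) ∧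
      ∑ i, ENNReal.ofReal ((r i / 2 ^ n) ^ s) ≤ nuT s n E + ε := by
  have h : nuT s n E < nuT s n E + ε := ENNReal.lt_add_right (nuT_lt_top s n E).ne hε
  obtain ⟨t, ⟨m, x, r, hx, hr, hc, rfl⟩, ht⟩ := sInf_lt_iff.1 h
  exact ⟨m, x, r, hx, hr, hc, ht.le⟩

theorem exists_sum_dyadic_sub_le {s : ℝ} (hs1 : s < 1) :
    ∃ C : ℝ, 0 ≤ C ∧ ∀ (n : ℕ) (r : ℝ), 0 ≤ r →
      ∑ k ∈ Finset.range (n + 1), (2 * r / 2 ^ k) ^ s * (80 * (2 ^ k / 2 ^ n)) ≤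
        C * (r / 2 ^ n) ^ s := by
  obtain ⟨C, hC, h⟩ := exists_sum_dyadic_le (ε := 1 - s) (by linarith)
  refine ⟨80 * 2 ^ s * C, by positivity, fun n r hr => ?_⟩
  have e : ∀ k ∈ Finset.range (n + 1), (2 * r / 2 ^ k) ^ s * (80 * (2 ^ k / 2 ^ n)) =
      80 * 2 ^ s * (r / 2 ^ n) ^ s * ((2 : ℝ) ^ k / 2 ^ n) ^ (1 - s) := fun k _ => by
    have h0 : (0 : ℝ) < 2 ^ k / 2 ^ n := by positivity
    have h1 : 2 * r / 2 ^ k = 2 * (r / 2 ^ n) / (2 ^ k / 2 ^ n) := by field_simp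
    rw [h1, Real.div_rpow (by positivity) h0.le, Real.mul_rpow (by norm_num) (by positivity),
      Real.rpow_sub h0, Real.rpow_one]
    ring
  rw [Finset.sum_congr rfl e, ← Finset.mul_sum]
  calc _ ≤ 80 * 2 ^ s * (r / 2 ^ n) ^ s * C := by gcongr; exact h n
    _ = _ := by ring

theorem ae_tsum_nuT_proj_lt_top {s : ℝ} (hs0 : 0 ≤ s) (hs1 : s < 1)
    {E : Set (EuclideanSpace ℝ (Fin 2))} (hE : ∑' n, nuT s n E < ⊤) :
    ∀ᵐ θ ∂angleMeasure, ∑' k, nuT s k ((fun x => inner ℝ x (eVec θ)) '' E) < ⊤ := by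
  obtain ⟨δ, hδ0, hδ⟩ := ENNReal.exists_pos_sum_of_countable' (ε := 1) one_ne_zero ℕ
  choose m x r hx hr hc ht using fun n => exists_cover_le s n E (hδ0 n).ne'
  let ι := Σ n : ℕ, Fin (m n)
  let c : ι → EuclideanSpace ℝ (Fin 2) := fun a => x a.1 a.2
  let ρ : ι → ℝ := fun a => r a.1 a.2
  have hρ : ∀ a, 1 ≤ ρ a := fun a => hr a.1 a.2
  have hcs : ∀ a : ι, c a ∈ shell _ a.1 := fun a => hx a.1 a.2
  let cost : ι → ℝ := fun a => (ρ a / 2 ^ a.1) ^ s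
  have hcost0 : ∀ a, 0 ≤ cost a := fun a => by
    have := hρ a
    positivity
  have hcost : ∑' a, ENNReal.ofReal (cost a) < ⊤ := by
    rw [ENNReal.tsum_sigma']
    refine lt_of_le_of_lt (ENNReal.tsum_le_tsum (g := fun n => nuT s n E + δ n) fun n => ?_) ?_
    · rw [tsum_fintype]
      exact ht n
    · rw [ENNReal.tsum_add]
      exact ENNReal.add_lt_top.2 ⟨hE, hδ.trans ENNReal.one_lt_top⟩
  -- only finitely many balls project close to the origin
  have hbad : ∀ᵐ θ ∂angleMeasure, {a : ι | θ ∈ {θ | |inner ℝ (c a) (eVec θ)| ≤ 2 * ρ a}}.Finite := by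
    refine ae_finite_setOfPred_mem (ne_top_of_le_ne_top ?_ (ENNReal.tsum_le_tsum
      (g := fun a => ENNReal.ofReal 80 * ENNReal.ofReal (cost a)) fun a => ?_))
    · rw [ENNReal.tsum_mul_left]
      exact ENNReal.mul_ne_top (by simp) hcost.ne
    · have h1 := hρ a
      rw [← ENNReal.ofReal_mul (by norm_num)]
      by_cases hle : ρ a / 2 ^ a.1 ≤ 1
      · refine (angleMeasure_abs_inner_le_of_mem_shell (hcs a) (by linarith)
          (Or.inr (by linarith))).trans (ENNReal.ofReal_le_ofReal ?_)
        have : ρ a / 2 ^ a.1 ≤ cost a := by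
          have h0 : 0 < ρ a / 2 ^ a.1 := by positivity
          simpa using Real.rpow_le_rpow_of_exponent_ge h0 hle hs1.le
        calc 40 * (2 * ρ a / 2 ^ a.1) = 80 * (ρ a / 2 ^ a.1) := by ring
          _ ≤ _ := by gcongr
      · refine (angleMeasure_le _).trans (ENNReal.ofReal_le_ofReal ?_)
        have : 1 ≤ cost a := Real.one_le_rpow (not_le.1 hle).le hs0
        linarith
  let D : ι → ℕ → Set ℝ := fun a k => {θ | |inner ℝ (c a) (eVec θ)| ≤ 2 * 2 ^ k}
  have hDm : ∀ a k, MeasurableSet (D a k) := fun a k =>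
    measurableSet_le (continuous_inner_eVec (c a)).abs.measurable measurable_const
  let f : ι → ℕ → ℝ → ℝ≥0∞ := fun a k =>
    if k < a.1 + 1 then (D a k).indicator fun _ => ENNReal.ofReal ((2 * ρ a / 2 ^ k) ^ s) else 0
  have hfm : ∀ a k, Measurable (f a k) := fun a k => by
    simp only [f]
    split_ifs
    · exact measurable_const.indicator (hDm a k)
    · exact measurable_const
  obtain ⟨C, hC0, hC⟩ := exists_sum_dyadic_sub_le hs1
  have hint : ∫⁻ θ, ∑' a, ∑' k, f a k θ ∂angleMeasure ≠ ⊤ := by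
    rw [lintegral_tsum fun a => (Measurable.tsum (hfm a)).aemeasurable]
    refine ne_top_of_le_ne_top ?_ (ENNReal.tsum_le_tsum
      (g := fun a => ENNReal.ofReal C * ENNReal.ofReal (cost a)) fun a => ?_)
    · rw [ENNReal.tsum_mul_left]
      exact ENNReal.mul_ne_top (by simp) hcost.ne
    · have h1 := hρ a
      rw [lintegral_tsum fun k => (hfm a k).aemeasurable, tsum_eq_sum (s := Finset.range (a.1 + 1))
        (fun k hk => by simp only [f, if_neg (Finset.mem_range.not.1 hk)]; simp), ← ENNReal.ofReal_mul hC0]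
      refine le_trans ?_ (ENNReal.ofReal_le_ofReal (hC a.1 (ρ a) (by linarith)))
      rw [ENNReal.ofReal_sum_of_nonneg fun k _ => by positivity]
      refine Finset.sum_le_sum fun k hk => ?_
      simp only [f, if_pos (Finset.mem_range.1 hk)]
      rw [lintegral_indicator_const (hDm a k), ENNReal.ofReal_mul (by positivity)]
      gcongr
      refine (angleMeasure_abs_inner_le_of_mem_shell (hcs a) (by positivity) (Or.inr ?_)).trans
        (le_of_eq ?_)
      · linarith [one_le_pow₀ (one_le_two (α := ℝ)) (n := k)]
      · congr 1
        ring
  have hmeas : Measurable fun θ => ∑' a, ∑' k, f a k θ :=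
    Measurable.tsum fun a => Measurable.tsum (hfm a)
  filter_upwards [hbad, ae_lt_top hmeas hint] with θ hfin hlt
  obtain ⟨K, hK⟩ : ∃ K : ℕ, ∀ a : ι, |inner ℝ (c a) (eVec θ)| ≤ 2 * ρ a → 3 * ρ a ≤ 2 ^ K := by
    obtain ⟨M, hM⟩ := (hfin.image ρ).bddAbove
    obtain ⟨K, hK⟩ := pow_unbounded_of_one_lt (3 * M) (one_lt_two (α := ℝ))
    exact ⟨K, fun a ha => by linarith [hM (mem_image_of_mem ρ ha)]⟩
  rw [ENNReal.tsum_comm] at hlt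
  set T := (fun x => inner ℝ x (eVec θ)) '' E with hT
  have hk : ∀ k, K < k → nuT s k T ≤ ∑' a, f a k θ := by
    intro k hKk
    have hk0 : k ≠ 0 := by omega
    have hfinite : ∑' a, f a k θ ≠ ⊤ := ((ENNReal.le_tsum k).trans_lt hlt).ne
    have hS := ENNReal.finite_const_le_of_tsum_ne_top hfinite
      (ε := ENNReal.ofReal ((2 / 2 ^ k) ^ s)) (by simp; positivity)
    have hval : ∀ a, k < a.1 + 1 → θ ∈ D a k →
        f a k θ = ENNReal.ofReal ((2 * ρ a / 2 ^ k) ^ s) := fun a h1 h2 => by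
      simp only [f, if_pos h1, indicator_of_mem h2]
    refine (nuT_le_sum (hS.toFinset.filter fun a => k < a.1 + 1 ∧ θ ∈ D a k)
      (fun a => inner ℝ (c a) (eVec θ)) ρ (fun a _ => hρ a) ?_).trans ?_
    · rintro _ ⟨⟨v, hvE, rfl⟩, hvk⟩
      have hy1 := norm_lt_of_mem_shell hvk
      have hy2 := half_le_norm_of_mem_shell hk0 hvk
      simp only [Real.norm_eq_abs] at hy1 hy2
      obtain ⟨n, hn⟩ := exists_mem_shell v
      obtain ⟨i, hi⟩ := mem_iUnion.1 (hc n ⟨hvE, hn⟩)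
      let a : ι := ⟨n, i⟩
      have hd : |inner ℝ v (eVec θ) - inner ℝ (c a) (eVec θ)| < ρ a :=
        (abs_inner_eVec_sub_le v (c a) θ).trans_lt hi
      have hd1 := abs_sub_abs_le_abs_sub (inner ℝ v (eVec θ)) (inner ℝ (c a) (eVec θ))
      have hd2 := abs_sub_abs_le_abs_sub (inner ℝ (c a) (eVec θ)) (inner ℝ v (eVec θ))
      rw [abs_sub_comm] at hd2
      have hgood : 2 * ρ a < |inner ℝ (c a) (eVec θ)| := by
        by_contra! hle
        have h3 := hK a hle
        have h4 : (2 : ℝ) ^ (K + 1) ≤ 2 ^ k := pow_le_pow_right₀ one_le_two hKk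
        rw [pow_succ] at h4
        linarith
      have hθD : θ ∈ D a k := by
        change |inner ℝ (c a) (eVec θ)| ≤ 2 * 2 ^ k
        linarith
      have hkn : k < n + 1 := by
        have h5 := (abs_inner_eVec_le v θ).trans_lt (norm_lt_of_mem_shell hn)
        have h6 : (2 : ℝ) ^ k < 2 ^ (n + 1) := by rw [pow_succ]; linarith
        exact (pow_lt_pow_iff_right₀ (one_lt_two (α := ℝ))).1 h6
      refine mem_iUnion₂.2 ⟨a, Finset.mem_filter.2 ⟨hS.mem_toFinset.2 ?_, hkn, hθD⟩, ?_⟩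
      · change _ ≤ f a k θ
        rw [hval a hkn hθD]
        refine ENNReal.ofReal_le_ofReal (Real.rpow_le_rpow (by positivity) ?_ hs0)
        gcongr
        linarith [hρ a]
      · rwa [mem_ball, Real.dist_eq]
    · refine le_trans (Finset.sum_le_sum fun a ha => ?_) (ENNReal.sum_le_tsum _)
      obtain ⟨-, h1, h2⟩ := Finset.mem_filter.1 ha
      exact (hval a h1 h2).ge
  rw [← ENNReal.summable.sum_add_tsum_nat_add' (k := K + 1)]
  refine ENNReal.add_lt_top.2 ⟨ENNReal.sum_lt_top.2 fun k _ => nuT_lt_top s k T, ?_⟩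
  calc ∑' k, nuT s (k + (K + 1)) T ≤ ∑' k, ∑' a, f a (k + (K + 1)) θ :=
        ENNReal.tsum_le_tsum fun k => hk _ (by omega)
    _ ≤ ∑' k, ∑' a, f a k θ :=
        ENNReal.tsum_comp_le_tsum_of_injective (add_left_injective (K + 1)) fun k => ∑' a, f a k θ
    _ < ⊤ := hlt

/-- Given finitely many capacity constraints, there is an admissible weight for which every point
lies in a saturated constraint set. -/
theorem exists_saturated_weight {α κ : Type*} [DecidableEq α] (F : Finset α) (I : Finset κ)
    (A : κ → Set α) [∀ a, DecidablePred (· ∈ A a)] (c : κ → ℝ) (hc : ∀ a ∈ I, 0 ≤ c a)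
    (hF : ∀ x ∈ F, ∃ a ∈ I, x ∈ A a) :
    ∃ w : α → ℝ, (∀ x, 0 ≤ w x) ∧ (∀ a ∈ I, ∑ x ∈ F with x ∈ A a, w x ≤ c a) ∧
      ∀ x ∈ F, ∃ a ∈ I, x ∈ A a ∧ ∑ y ∈ F with y ∈ A a, w y = c a := by
  induction F using Finset.induction_on with
  | empty => exact ⟨fun _ => 0, fun _ => le_rfl, by simpa using hc, by simp⟩
  | insert x₀ F hx₀ ih =>
    obtain ⟨w, hw0, hw1, hw2⟩ := ih fun x hx => hF x (Finset.mem_insert_of_mem hx)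
    obtain ⟨a₀, ha₀, hmin⟩ := Finset.exists_min_image (I.filter fun a => x₀ ∈ A a)
      (fun a => c a - ∑ x ∈ F with x ∈ A a, w x) (by
        obtain ⟨a, ha, hxa⟩ := hF x₀ (Finset.mem_insert_self _ _)
        exact ⟨a, Finset.mem_filter.2 ⟨ha, hxa⟩⟩)
    obtain ⟨ha₀I, ha₀x⟩ := Finset.mem_filter.1 ha₀
    set d := c a₀ - ∑ x ∈ F with x ∈ A a₀, w x with hd
    have hd0 : 0 ≤ d := sub_nonneg.2 (hw1 a₀ ha₀I)
    have hsum : ∀ a, ∑ x ∈ F with x ∈ A a, Function.update w x₀ d x = ∑ x ∈ F with x ∈ A a, w x :=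
      fun a => Finset.sum_congr rfl fun x hx => Function.update_of_ne
        (fun h : x = x₀ => hx₀ (h ▸ (Finset.mem_filter.1 hx).1)) _ _
    have hin : ∀ a, x₀ ∈ A a → ∑ x ∈ insert x₀ F with x ∈ A a, Function.update w x₀ d x
        = d + ∑ x ∈ F with x ∈ A a, w x := fun a ha => by
      rw [Finset.filter_insert, if_pos ha, Finset.sum_insert (by simp [hx₀]), hsum]
      simp
    have hout : ∀ a, x₀ ∉ A a → ∑ x ∈ insert x₀ F with x ∈ A a, Function.update w x₀ d x
        = ∑ x ∈ F with x ∈ A a, w x := fun a ha => by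
      rw [Finset.filter_insert, if_neg ha, hsum]
    have hle : ∀ a ∈ I, ∑ x ∈ insert x₀ F with x ∈ A a, Function.update w x₀ d x ≤ c a := by
      intro a ha
      by_cases hxa : x₀ ∈ A a
      · rw [hin a hxa]
        linarith [hmin a (Finset.mem_filter.2 ⟨ha, hxa⟩)]
      · rw [hout a hxa]
        exact hw1 a ha
    refine ⟨Function.update w x₀ d, fun x => ?_, hle, fun x hx => ?_⟩
    · by_cases h : x = x₀
      · rw [h, Function.update_self]; exact hd0
      · rw [Function.update_of_ne h]; exact hw0 x
    · rcases Finset.mem_insert.1 hx with rfl | hxF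
      · refine ⟨a₀, ha₀I, ha₀x, ?_⟩
        rw [hin a₀ ha₀x, hd]; ring
      · obtain ⟨a, ha, hxa, hsat⟩ := hw2 x hxF
        refine ⟨a, ha, hxa, le_antisymm (hle a ha) ?_⟩
        by_cases hx₀a : x₀ ∈ A a
        · rw [hin a hx₀a, hsat]; linarith
        · rw [hout a hx₀a, hsat]

open Classical in
/-- A finite Frostman lemma at scales between `1` and `2 ^ (n + 1)`. -/
theorem exists_frostman_weight {X : Type*} [NormedAddCommGroup X] [ProperSpace X] {s : ℝ}
    (n : ℕ) (E : Set X) :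
    ∃ (F : Finset X) (w : X → ℝ), ↑F ⊆ E ∩ shell X n ∧ (∀ x, 0 ≤ w x) ∧
      (∀ y ∈ F, ∀ j ∈ Finset.range (n + 2),
        ∑ x ∈ F with dist x y ≤ 2 ^ j, w x ≤ ((2 : ℝ) ^ j / 2 ^ n) ^ s) ∧
      nuT s n E ≤ ENNReal.ofReal (14 ^ s * ∑ x ∈ F, w x) := by
  have htb : TotallyBounded (E ∩ shell X n) := by
    refine ((isCompact_closedBall (0 : X) (2 ^ n)).totallyBounded).subset fun y hy => ?_
    simpa using (norm_lt_of_mem_shell hy.2).le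
  obtain ⟨F₀, hF₀s, hF₀f, hF₀c⟩ := Metric.finite_approx_of_totallyBounded htb 1 one_pos
  set F := hF₀f.toFinset with hF
  have hFE : ↑F ⊆ E ∩ shell X n := by simpa [hF] using hF₀s
  let A : X × ℕ → Set X := fun a => closedBall a.1 (2 ^ a.2)
  let c : X × ℕ → ℝ := fun a => ((2 : ℝ) ^ a.2 / 2 ^ n) ^ s
  obtain ⟨w, hw0, hw1, hw2⟩ := exists_saturated_weight F (F ×ˢ Finset.range (n + 2)) A c
    (fun a _ => by positivity)
    (fun x hx => ⟨(x, 0), Finset.mk_mem_product hx (by simp), by simp [A]⟩)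
  refine ⟨F, w, hFE, hw0, fun y hy j hj => hw1 (y, j) (Finset.mk_mem_product hy hj), ?_⟩
  let t : Set (X × ℕ) := {a | a ∈ F ×ˢ Finset.range (n + 2) ∧ ∑ x ∈ F with x ∈ A a, w x = c a}
  obtain ⟨u, hut, hud, huc⟩ := Vitali.exists_disjoint_subfamily_covering_enlargement_closedBall t
    (fun a => a.1) (fun a => 2 ^ a.2) (2 ^ (n + 2)) (fun a ha => by
      have := Finset.mem_range.1 (Finset.mem_product.1 ha.1).2
      exact pow_le_pow_right₀ one_le_two this.le) 5 (by norm_num)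
  have hufin : u.Finite := (F ×ˢ Finset.range (n + 2)).finite_toSet.subset fun a ha => (hut ha).1
  refine (nuT_le_sum hufin.toFinset (fun a => a.1) (fun a => 7 * 2 ^ a.2) (fun a _ => ?_)
    fun y hy => ?_).trans ?_
  · linarith [one_le_pow₀ (one_le_two (α := ℝ)) (n := a.2)]
  · obtain ⟨x, hx, hyx⟩ := mem_iUnion₂.1 (hF₀c hy)
    obtain ⟨a, haI, hxa, hsat⟩ := hw2 x (hF₀f.mem_toFinset.2 hx)
    obtain ⟨b, hb, hab⟩ := huc a ⟨haI, hsat⟩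
    refine mem_iUnion₂.2 ⟨b, hufin.mem_toFinset.2 hb, ?_⟩
    have h1 := hab hxa
    simp only [mem_ball, mem_closedBall] at h1 hyx ⊢
    have := dist_triangle y x b.1
    linarith [one_le_pow₀ (one_le_two (α := ℝ)) (n := b.2)]
  · rw [← ENNReal.ofReal_sum_of_nonneg fun a _ => by positivity]
    refine ENNReal.ofReal_le_ofReal ?_
    have e : ∀ a ∈ hufin.toFinset, (2 * (7 * 2 ^ a.2) / 2 ^ n : ℝ) ^ s
        = 14 ^ s * ∑ x ∈ F with x ∈ A a, w x := fun a ha => by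
      rw [(hut (hufin.mem_toFinset.1 ha)).2, ← Real.mul_rpow (by norm_num) (by positivity)]
      congr 1
      ring
    rw [Finset.sum_congr rfl e, ← Finset.mul_sum]
    gcongr
    rw [← Finset.sum_biUnion]
    · refine Finset.sum_le_sum_of_subset_of_nonneg ?_ fun x _ _ => hw0 x
      exact Finset.biUnion_subset.2 fun a _ => Finset.filter_subset _ _
    · intro a ha b hb hne
      have hd := hud (hufin.mem_toFinset.1 ha) (hufin.mem_toFinset.1 hb) hne
      refine Finset.disjoint_left.2 fun x hx hx' => ?_
      exact Set.disjoint_left.1 hd (Finset.mem_filter.1 hx).2 (Finset.mem_filter.1 hx').2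

/-- The dyadic version of the Riesz kernel `(2 ^ n / max d 1) ^ t`. -/
noncomputable def dyadicKernel (t : ℝ) (n : ℕ) (d : ℝ) : ℝ :=
  ∑ j ∈ Finset.range (n + 1), if d ≤ 4 * 2 ^ j then ((2 : ℝ) ^ n / 2 ^ j) ^ t else 0

theorem dyadicKernel_nonneg (t : ℝ) (n : ℕ) (d : ℝ) : 0 ≤ dyadicKernel t n d :=
  Finset.sum_nonneg fun j _ => by split_ifs <;> positivity

theorem rpow_le_dyadicKernel {t : ℝ} (ht : 0 ≤ t) {n : ℕ} {d r : ℝ} (hr : 1 ≤ r)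
    (hdr : d < 2 * r) (hdn : d < 2 * 2 ^ n) : (2 ^ n / r) ^ t ≤ dyadicKernel t n d := by
  obtain ⟨i, hi1, hi2⟩ := exists_nat_pow_near hr (one_lt_two (α := ℝ))
  have key : ∀ j ≤ n, (2 : ℝ) ^ j ≤ r → d ≤ 4 * 2 ^ j → (2 ^ n / r) ^ t ≤ dyadicKernel t n d := by
    intro j hj hjr hd
    refine le_trans ?_ (Finset.single_le_sum
      (f := fun j => if d ≤ 4 * 2 ^ j then ((2 : ℝ) ^ n / 2 ^ j) ^ t else 0)
      (fun j _ => by split_ifs <;> positivity) (Finset.mem_range.2 (Nat.lt_succ_of_le hj)))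
    simp only [if_pos hd]
    refine Real.rpow_le_rpow (by positivity) ?_ ht
    gcongr
  rcases le_total i n with hin | hni
  · refine key i hin hi1 ?_
    rw [pow_succ] at hi2
    linarith
  · refine key n le_rfl ((pow_le_pow_right₀ one_le_two hni).trans hi1) ?_
    have : (0 : ℝ) < 2 ^ n := by positivity
    linarith

/-- Lower bound for the cost of a cover in terms of an energy. -/
theorem sq_div_energy_le_nuT {α : Type*} {t : ℝ} (ht : 0 ≤ t) {n k : ℕ} (hk : k ≤ n)
    {F F' : Finset α} (hFF : F' ⊆ F) {w : α → ℝ} (hw : ∀ x, 0 ≤ w x) {p : α → ℝ}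
    (hp : ∀ x ∈ F', |p x| < 2 ^ n) {T : Set ℝ} (hT : ∀ x ∈ F', p x ∈ T ∩ shell ℝ k) {M : ℝ}
    (hM0 : 0 < M) (hM : ∑ x ∈ F, ∑ y ∈ F, w x * w y * dyadicKernel t n |p x - p y| ≤ M) :
    ENNReal.ofReal ((∑ x ∈ F', w x) ^ 2 / M) ≤ nuT t k T := by
  classical
  rcases F'.eq_empty_or_nonempty with rfl | ⟨x₀, hx₀⟩
  · simp
  refine le_sInf ?_
  rintro _ ⟨m, x, r, hx, hr, hc, rfl⟩
  have hcov : ∀ z ∈ F', ∃ i, p z ∈ ball (x i) (r i) := fun z hz => mem_iUnion.1 (hc (hT z hz))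
  have : Nonempty (Fin m) := ⟨(hcov x₀ hx₀).choose⟩
  choose! g hg using hcov
  let W : Fin m → ℝ := fun i => ∑ z ∈ F' with g z = i, w z
  let a : Fin m → ℝ := fun i => (r i / 2 ^ n) ^ t
  have ha : ∀ i, 0 < a i := fun i => by
    have := hr i
    positivity
  have hker : ∀ z ∈ F', ∀ y ∈ F', g z = g y → (a (g z))⁻¹ ≤ dyadicKernel t n |p z - p y| := by
    intro z hz y hy hzy
    have h1 := hr (g z)
    have e : (a (g z))⁻¹ = (2 ^ n / r (g z)) ^ t := by
      rw [← Real.inv_rpow (by positivity), inv_div]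
    rw [e]
    refine rpow_le_dyadicKernel ht h1 ?_ ?_
    · have h2 := hg z hz
      have h3 := hg y hy
      rw [← hzy] at h3
      rw [mem_ball] at h2 h3
      have := dist_triangle_right (p z) (p y) (x (g z))
      rw [← Real.dist_eq]
      linarith
    · linarith [abs_sub (p z) (p y), hp z hz, hp y hy]
  have hnn : ∀ z y, 0 ≤ w z * w y * dyadicKernel t n |p z - p y| := fun z y =>
    mul_nonneg (mul_nonneg (hw z) (hw y)) (dyadicKernel_nonneg _ _ _)
  have hWM : ∑ i, W i ^ 2 / a i ≤ M := by
    refine le_trans ?_ hM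
    calc ∑ i, W i ^ 2 / a i
        ≤ ∑ i, ∑ z ∈ F' with g z = i, ∑ y ∈ F, w z * w y * dyadicKernel t n |p z - p y| := by
          refine Finset.sum_le_sum fun i _ => ?_
          rw [sq, div_eq_mul_inv, Finset.sum_mul_sum, Finset.sum_mul]
          refine Finset.sum_le_sum fun z hz => ?_
          rw [Finset.sum_mul]
          obtain ⟨hz1, hz2⟩ := Finset.mem_filter.1 hz
          refine le_trans (Finset.sum_le_sum fun y hy => ?_)
            (Finset.sum_le_sum_of_subset_of_nonneg ((Finset.filter_subset _ _).trans hFF)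
              fun y _ _ => hnn z y)
          obtain ⟨hy1, hy2⟩ := Finset.mem_filter.1 hy
          have := hker z hz1 y hy1 (hz2.trans hy2.symm)
          rw [hz2] at this
          have h0 := mul_nonneg (hw z) (hw y)
          gcongr
      _ = ∑ z ∈ F', ∑ y ∈ F, w z * w y * dyadicKernel t n |p z - p y| :=
          Finset.sum_fiberwise F' g _
      _ ≤ _ := Finset.sum_le_sum_of_subset_of_nonneg hFF
          fun z _ _ => Finset.sum_nonneg fun y _ => hnn z y
  have hW : ∑ i, W i = ∑ z ∈ F', w z := Finset.sum_fiberwise F' g w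
  have htitu := (Finset.sq_sum_div_le_sum_sq_div Finset.univ W (fun i _ => ha i)).trans hWM
  have hapos : 0 < ∑ i, a i := Finset.sum_pos (fun i _ => ha i) Finset.univ_nonempty
  rw [hW, div_le_iff₀ hapos] at htitu
  rw [← ENNReal.ofReal_sum_of_nonneg fun i _ => by
    have := hr i
    positivity]
  refine ENNReal.ofReal_le_ofReal ?_
  rw [div_le_iff₀ hM0, mul_comm]
  refine htitu.trans (mul_le_mul_of_nonneg_left (Finset.sum_le_sum fun i _ => ?_) hM0.le)
  have := hr i
  refine Real.rpow_le_rpow (by positivity) ?_ ht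
  gcongr
  exact one_le_two

/-- Markov's inequality for finite weighted sums of indicators. -/
theorem measure_lt_weighted_sum_le {Ω ι : Type*} [MeasurableSpace Ω] (μ : Measure Ω)
    (I : Finset ι) {c p : ι → ℝ} (hc : ∀ i ∈ I, 0 ≤ c i) {A : ι → Set Ω}
    [∀ i, DecidablePred (· ∈ A i)] (hA : ∀ i, MeasurableSet (A i))
    (hp : ∀ i ∈ I, μ (A i) ≤ ENNReal.ofReal (p i)) (hp0 : ∀ i ∈ I, 0 ≤ p i) {B M : ℝ} (hM : 0 < M)
    (hB : ∑ i ∈ I, c i * p i ≤ B) :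
    μ {ω | M < ∑ i ∈ I, if ω ∈ A i then c i else 0} ≤ ENNReal.ofReal (B / M) := by
  let f : Ω → ℝ≥0∞ := fun ω => ∑ i ∈ I, (A i).indicator (fun _ => ENNReal.ofReal (c i)) ω
  have hfe : ∀ ω, f ω = ENNReal.ofReal (∑ i ∈ I, if ω ∈ A i then c i else 0) := fun ω => by
    rw [ENNReal.ofReal_sum_of_nonneg fun i hi => by split_ifs; exacts [hc i hi, le_rfl]]
    refine Finset.sum_congr rfl fun i _ => ?_
    by_cases h : ω ∈ A i <;> simp [h]
  have hfm : Measurable f :=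
    Finset.measurable_fun_sum I fun i _ => measurable_const.indicator (hA i)
  have hint : ∫⁻ ω, f ω ∂μ ≤ ENNReal.ofReal B := by
    rw [lintegral_finsetSum I fun i _ => measurable_const.indicator (hA i)]
    refine le_trans ?_ (ENNReal.ofReal_le_ofReal hB)
    rw [ENNReal.ofReal_sum_of_nonneg fun i hi => mul_nonneg (hc i hi) (hp0 i hi)]
    refine Finset.sum_le_sum fun i hi => ?_
    rw [lintegral_indicator_const (hA i), ENNReal.ofReal_mul (hc i hi)]
    gcongr
    exact hp i hi
  calc μ {ω | M < ∑ i ∈ I, if ω ∈ A i then c i else 0}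
      ≤ μ {ω | ENNReal.ofReal M ≤ f ω} := measure_mono fun ω hω => by
        rw [mem_ofPred_eq, hfe]
        exact ENNReal.ofReal_le_ofReal (le_of_lt hω)
    _ ≤ (∫⁻ ω, f ω ∂μ) / ENNReal.ofReal M :=
        meas_ge_le_lintegral_div hfm.aemeasurable (by simpa using hM) ENNReal.ofReal_ne_top
    _ ≤ ENNReal.ofReal B / ENNReal.ofReal M := by gcongr
    _ = _ := (ENNReal.ofReal_div_of_pos hM).symm

theorem angleMeasure_abs_inner_le_rpow {s : ℝ} (hs0 : 0 ≤ s) (hs1 : s ≤ 1)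
    (z : EuclideanSpace ℝ (Fin 2)) {u : ℝ} (hu : 1 ≤ u) :
    angleMeasure {θ | |inner ℝ z (eVec θ)| ≤ 4 * u} ≤
      ENNReal.ofReal (80 * (u / max ‖z‖ 1) ^ s) := by
  have hm : 0 < max ‖z‖ 1 := lt_max_of_lt_right one_pos
  by_cases hv : 1 ≤ u / max ‖z‖ 1
  · refine (angleMeasure_le _).trans (ENNReal.ofReal_le_ofReal ?_)
    linarith [Real.one_le_rpow hv hs0]
  rw [not_le] at hv
  have hz : 1 < ‖z‖ := by
    by_contra! h
    rw [max_eq_right h, div_one] at hv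
    linarith
  rw [max_eq_left hz.le] at hv ⊢
  have hz0 : 0 < ‖z‖ := by linarith
  refine (angleMeasure_abs_inner_le hz0 (by positivity)).trans (ENNReal.ofReal_le_ofReal ?_)
  have h0 : 0 < u / ‖z‖ := by positivity
  have : u / ‖z‖ ≤ (u / ‖z‖) ^ s := by
    simpa using Real.rpow_le_rpow_of_exponent_ge h0 hv.le hs1
  calc 20 * (4 * u) / ‖z‖ = 80 * (u / ‖z‖) := by ring
    _ ≤ _ := by gcongr

/-- The averaged dyadic kernel is dominated by a Riesz kernel of larger exponent. -/
theorem exists_sum_dyadicKernel_le {t s : ℝ} (hts : t < s) :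
    ∃ C : ℝ, 0 < C ∧ ∀ (n : ℕ) (ρ : ℝ), 0 < ρ →
      ∑ j ∈ Finset.range (n + 1), ((2 : ℝ) ^ n / 2 ^ j) ^ t * (80 * (2 ^ j / ρ) ^ s) ≤
        C * (2 ^ n / ρ) ^ s := by
  obtain ⟨C, hC, h⟩ := exists_sum_dyadic_le (ε := s - t) (by linarith)
  refine ⟨80 * C, by positivity, fun n ρ hρ => ?_⟩
  have e : ∀ j ∈ Finset.range (n + 1), ((2 : ℝ) ^ n / 2 ^ j) ^ t * (80 * (2 ^ j / ρ) ^ s) =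
      80 * (2 ^ n / ρ) ^ s * ((2 : ℝ) ^ j / 2 ^ n) ^ (s - t) := fun j _ => by
    have h0 : (0 : ℝ) < 2 ^ j / 2 ^ n := by positivity
    have h1 : (2 : ℝ) ^ j / ρ = (2 ^ n / ρ) * (2 ^ j / 2 ^ n) := by field_simp
    have h2 : (2 : ℝ) ^ n / 2 ^ j = (2 ^ j / 2 ^ n)⁻¹ := by rw [inv_div]
    rw [h1, h2, Real.mul_rpow (by positivity) h0.le, Real.rpow_sub h0, Real.inv_rpow h0.le]
    ring
  rw [Finset.sum_congr rfl e, ← Finset.mul_sum]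
  calc _ ≤ 80 * (2 ^ n / ρ) ^ s * C := by gcongr; exact h n
    _ = _ := by ring

/-- A Frostman measure of exponent `s` has bounded Riesz potentials of smaller exponents. -/
theorem exists_potential_le {s s' : ℝ} (hs0 : 0 ≤ s') (hss : s' < s) :
    ∃ C : ℝ, 0 < C ∧ ∀ {X : Type*} [PseudoMetricSpace X] (n : ℕ) (F : Finset X) (w : X → ℝ)
      (x : X), (∀ y, 0 ≤ w y) → (∀ y ∈ F, dist y x < 2 * 2 ^ n) →
      (∀ j ∈ Finset.range (n + 2),
        ∑ y ∈ F with dist y x ≤ 2 ^ j, w y ≤ ((2 : ℝ) ^ j / 2 ^ n) ^ s) →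
      ∑ y ∈ F, w y * (2 ^ n / max (dist y x) 1) ^ s' ≤ C := by
  obtain ⟨C, hC, h⟩ := exists_sum_dyadic_le (ε := s - s') (by linarith)
  refine ⟨2 ^ s * C, by positivity, fun {X} _ n F w x hw hd hF => ?_⟩
  have hpt : ∀ y ∈ F, ((2 : ℝ) ^ n / max (dist y x) 1) ^ s' ≤
      ∑ i ∈ Finset.range (n + 2), if dist y x ≤ 2 ^ i then (2 * 2 ^ n / 2 ^ i : ℝ) ^ s' else 0 := by
    intro y hy
    obtain ⟨i, hin, hi1, hi2⟩ : ∃ i < n + 2, dist y x ≤ 2 ^ i ∧ 2 ^ i ≤ 2 * max (dist y x) 1 := by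
      rcases le_or_gt (dist y x) 1 with h1 | h1
      · exact ⟨0, by omega, by simpa using h1, by rw [max_eq_right h1]; norm_num⟩
      · obtain ⟨i, hi1, hi2⟩ := exists_nat_pow_near h1.le (one_lt_two (α := ℝ))
        refine ⟨i + 1, ?_, hi2.le, ?_⟩
        · have : (2 : ℝ) ^ i < 2 ^ (n + 1) := by rw [pow_succ]; linarith [hd y hy]
          have := (pow_lt_pow_iff_right₀ (one_lt_two (α := ℝ))).1 this
          omega
        · rw [max_eq_left h1.le, pow_succ]; linarith
    refine le_trans ?_ (Finset.single_le_sum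
      (f := fun i => if dist y x ≤ 2 ^ i then (2 * 2 ^ n / 2 ^ i : ℝ) ^ s' else 0)
      (fun j _ => by split_ifs <;> positivity) (Finset.mem_range.2 hin))
    simp only [if_pos hi1]
    have hm : 0 < max (dist y x) 1 := lt_max_of_lt_right one_pos
    refine Real.rpow_le_rpow (by positivity) ?_ hs0
    rw [div_le_div_iff₀ hm (by positivity)]
    calc (2 : ℝ) ^ n * 2 ^ i ≤ 2 ^ n * (2 * max (dist y x) 1) := by gcongr
      _ = _ := by ring
  calc ∑ y ∈ F, w y * (2 ^ n / max (dist y x) 1) ^ s'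
      ≤ ∑ y ∈ F, w y * ∑ i ∈ Finset.range (n + 2),
          if dist y x ≤ 2 ^ i then (2 * 2 ^ n / 2 ^ i : ℝ) ^ s' else 0 :=
        Finset.sum_le_sum fun y hy => mul_le_mul_of_nonneg_left (hpt y hy) (hw y)
    _ = ∑ i ∈ Finset.range (n + 2),
          (2 * 2 ^ n / 2 ^ i : ℝ) ^ s' * ∑ y ∈ F with dist y x ≤ 2 ^ i, w y := by
        simp only [Finset.mul_sum, Finset.sum_filter]
        rw [Finset.sum_comm]
        refine Finset.sum_congr rfl fun i _ => Finset.sum_congr rfl fun y _ => ?_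
        split_ifs <;> ring
    _ ≤ ∑ i ∈ Finset.range (n + 1 + 1), 2 ^ s * ((2 : ℝ) ^ i / 2 ^ (n + 1)) ^ (s - s') := by
        refine Finset.sum_le_sum fun i hi => ?_
        refine (mul_le_mul_of_nonneg_left (hF i hi) (by positivity)).trans (le_of_eq ?_)
        have h0 : (0 : ℝ) < 2 ^ i / 2 ^ (n + 1) := by positivity
        have h1 : (2 * 2 ^ n / 2 ^ i : ℝ) = (2 ^ i / 2 ^ (n + 1))⁻¹ := by
          rw [inv_div, pow_succ]; ring
        have h2 : (2 : ℝ) ^ i / 2 ^ n = 2 * (2 ^ i / 2 ^ (n + 1)) := by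
          rw [pow_succ]; field_simp
        rw [h1, h2, Real.mul_rpow (by norm_num) h0.le, Real.rpow_sub h0, Real.inv_rpow h0.le]
        ring
    _ ≤ 2 ^ s * C := by
        rw [← Finset.mul_sum]
        gcongr
        exact h (n + 1)

open Classical in
/-- Off a set of angles of measure at most `δ`, the energy of the projected weight is controlled. -/
theorem exists_energy_const {t s : ℝ} (ht : 0 ≤ t) (hts : t < s) (hs1 : s < 1) :
    ∃ C : ℝ, 0 < C ∧ ∀ (n : ℕ) (F : Finset (EuclideanSpace ℝ (Fin 2)))
      (w : EuclideanSpace ℝ (Fin 2) → ℝ), (∀ x ∈ F, x ∈ shell _ n) → (∀ x, 0 ≤ w x) →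
      (∀ y ∈ F, ∀ j ∈ Finset.range (n + 2),
        ∑ x ∈ F with dist x y ≤ 2 ^ j, w x ≤ ((2 : ℝ) ^ j / 2 ^ n) ^ s) →
      ∀ M : ℝ, 0 < M →
      angleMeasure {θ | M < ∑ x ∈ F, ∑ y ∈ F, w x * w y *
        dyadicKernel t n |inner ℝ x (eVec θ) - inner ℝ y (eVec θ)|} ≤
      ENNReal.ofReal (C * (∑ x ∈ F, w x) / M) := by
  obtain ⟨s', hts', hs's⟩ := exists_between hts
  obtain ⟨C₁, hC₁, h₁⟩ := exists_sum_dyadicKernel_le hts'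
  obtain ⟨C₂, hC₂, h₂⟩ := exists_potential_le (by linarith : 0 ≤ s') hs's
  refine ⟨C₁ * C₂, by positivity, fun n F w hF hw hwF M hM => ?_⟩
  let I := F ×ˢ F ×ˢ Finset.range (n + 1)
  let c : EuclideanSpace ℝ (Fin 2) × EuclideanSpace ℝ (Fin 2) × ℕ → ℝ :=
    fun a => w a.1 * w a.2.1 * ((2 : ℝ) ^ n / 2 ^ a.2.2) ^ t
  let p : EuclideanSpace ℝ (Fin 2) × EuclideanSpace ℝ (Fin 2) × ℕ → ℝ :=
    fun a => 80 * (2 ^ a.2.2 / max (dist a.2.1 a.1) 1) ^ s'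
  let A : EuclideanSpace ℝ (Fin 2) × EuclideanSpace ℝ (Fin 2) × ℕ → Set ℝ :=
    fun a => {θ | |inner ℝ (a.1 - a.2.1) (eVec θ)| ≤ 4 * 2 ^ a.2.2}
  have hmax : ∀ x y : EuclideanSpace ℝ (Fin 2), 0 < max (dist y x) 1 := fun x y =>
    lt_max_of_lt_right one_pos
  have key := measure_lt_weighted_sum_le angleMeasure I (c := c) (p := p) (A := A)
    (B := C₁ * C₂ * ∑ x ∈ F, w x) (M := M)
    (fun a _ => mul_nonneg (mul_nonneg (hw _) (hw _)) (by positivity))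
    (fun a => measurableSet_le (continuous_inner_eVec _).abs.measurable measurable_const)
    (fun a _ => by
      have := angleMeasure_abs_inner_le_rpow (by linarith : 0 ≤ s') (by linarith) (a.1 - a.2.1)
        (u := 2 ^ a.2.2) (one_le_pow₀ one_le_two)
      rwa [← dist_eq_norm, dist_comm] at this)
    (fun a _ => by
      have := hmax a.1 a.2.1
      positivity) hM (by
      simp only [I, c, p, Finset.sum_product]
      rw [Finset.mul_sum]
      refine Finset.sum_le_sum fun x hx => ?_
      calc ∑ y ∈ F, ∑ j ∈ Finset.range (n + 1), w x * w y * ((2 : ℝ) ^ n / 2 ^ j) ^ t *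
            (80 * (2 ^ j / max (dist y x) 1) ^ s')
          ≤ ∑ y ∈ F, w x * C₁ * (w y * (2 ^ n / max (dist y x) 1) ^ s') := by
            refine Finset.sum_le_sum fun y _ => ?_
            have := mul_le_mul_of_nonneg_left (h₁ n _ (hmax x y)) (mul_nonneg (hw x) (hw y))
            rw [Finset.mul_sum] at this
            simp only [mul_assoc] at this ⊢
            refine this.trans (le_of_eq (by ring))
        _ ≤ w x * C₁ * C₂ := by
            rw [← Finset.mul_sum]
            have h0 := mul_nonneg (hw x) hC₁.le
            gcongr
            refine h₂ n F w x hw (fun y hy => dist_lt_of_mem_shell (hF y hy) (hF x hx)) fun j hj => ?_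
            exact hwF x hx j hj
        _ = C₁ * C₂ * w x := by ring)
  convert key using 4 with θ
  simp only [I, c, A, Finset.sum_product, dyadicKernel, Finset.mul_sum, mul_ite, mul_zero,
    mem_ofPred_eq, inner_sub_left]

/-- Off a set of angles of measure at most `δ`, the projection of the `n`-th shell of `E` has large
cost in the shells `n - J, …, n`. -/
theorem exists_good_angles {t s δ : ℝ} (ht : 0 ≤ t) (hts : t < s) (hs1 : s < 1) (hδ : 0 < δ) :
    ∃ (J : ℕ) (c : ℝ), 0 < c ∧ ∀ (E : Set (EuclideanSpace ℝ (Fin 2))) (n : ℕ), n ≠ 0 →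
      ∃ G : Set ℝ, MeasurableSet G ∧ angleMeasure Gᶜ ≤ ENNReal.ofReal δ ∧
        ∀ θ ∈ G, ENNReal.ofReal c * nuT s n E ≤
          ∑ k ∈ Finset.Icc (n - J) n, nuT t k ((fun x => inner ℝ x (eVec θ)) '' E) := by
  classical
  obtain ⟨C, hC, hen⟩ := exists_energy_const ht hts hs1
  obtain ⟨J, hJ⟩ := pow_unbounded_of_one_lt (80 / δ) (one_lt_two (α := ℝ))
  have hc : 0 < δ / (8 * (J + 1) * C * 14 ^ s) := by positivity
  refine ⟨J, _, hc, fun E n hn => ?_⟩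
  obtain ⟨F, w, hFE, hw, hwF, hnu⟩ := exists_frostman_weight (s := s) n E
  have hFs : ∀ x ∈ F, x ∈ shell _ n := fun x hx => (hFE hx).2
  set m := ∑ x ∈ F, w x with hm
  have hm' : 0 ≤ m := Finset.sum_nonneg fun x _ => hw x
  rcases hm'.eq_or_lt with hm0 | hm0
  · refine ⟨univ, MeasurableSet.univ, by simp, fun θ _ => ?_⟩
    rw [← hm0, mul_zero, ENNReal.ofReal_zero] at hnu
    rw [le_antisymm hnu bot_le, mul_zero]
    exact bot_le
  set M := 2 * C * m / δ with hM
  have hM0 : 0 < M := by positivity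
  let Φ : ℝ → ℝ := fun θ => ∑ x ∈ F, ∑ y ∈ F, w x * w y *
    dyadicKernel t n |inner ℝ x (eVec θ) - inner ℝ y (eVec θ)|
  let A : EuclideanSpace ℝ (Fin 2) → Set ℝ := fun x =>
    {θ | |inner ℝ x (eVec θ)| ≤ 2 ^ n / 2 ^ (J + 1)}
  let L : ℝ → ℝ := fun θ => ∑ x ∈ F, if θ ∈ A x then w x else 0
  have hAm : ∀ x, MeasurableSet (A x) := fun x =>
    measurableSet_le (continuous_inner_eVec _).abs.measurable measurable_const
  have hΦ : angleMeasure {θ | M < Φ θ} ≤ ENNReal.ofReal (δ / 2) := by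
    refine (hen n F w hFs hw hwF M hM0).trans (le_of_eq ?_)
    congr 1
    rw [← hm, hM]
    field_simp
  have hL : angleMeasure {θ | m / 2 < L θ} ≤ ENNReal.ofReal (δ / 2) := by
    refine (measure_lt_weighted_sum_le angleMeasure F (c := w)
      (p := fun _ => 40 * (2 ^ n / 2 ^ (J + 1) / 2 ^ n)) (B := m * (20 / 2 ^ J)) (fun x _ => hw x)
      hAm (fun x hx => angleMeasure_abs_inner_le_of_mem_shell (hFs x hx) (by positivity)
        (Or.inl hn)) (fun _ _ => by positivity) (half_pos hm0) ?_).trans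
      (ENNReal.ofReal_le_ofReal ?_)
    · rw [← Finset.sum_mul, pow_succ]
      refine le_of_eq ?_
      field_simp
      ring
    · rw [div_lt_iff₀ hδ] at hJ
      have e : m * (20 / 2 ^ J) / (m / 2) = 40 / 2 ^ J := by field_simp; ring
      rw [e, div_le_div_iff₀ (by positivity) (by norm_num)]
      linarith
  have hΦm : Measurable Φ := by
    refine Finset.measurable_fun_sum F fun x _ => Finset.measurable_fun_sum F fun y _ =>
      Measurable.const_mul ?_ _
    refine Finset.measurable_fun_sum _ fun j _ => Measurable.ite ?_ measurable_const measurable_const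
    exact measurableSet_le
      ((continuous_inner_eVec x).sub (continuous_inner_eVec y)).abs.measurable measurable_const
  have hLm : Measurable L :=
    Finset.measurable_fun_sum F fun x _ => Measurable.ite (hAm x) measurable_const measurable_const
  refine ⟨{θ | Φ θ ≤ M} ∩ {θ | L θ ≤ m / 2}, (measurableSet_le hΦm measurable_const).inter
    (measurableSet_le hLm measurable_const), ?_, ?_⟩
  · have e : ({θ | Φ θ ≤ M} ∩ {θ | L θ ≤ m / 2})ᶜ = {θ | M < Φ θ} ∪ {θ | m / 2 < L θ} := by
      ext θ
      simp only [mem_compl_iff, mem_inter_iff, mem_ofPred_eq, mem_union, not_and_or, not_le]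
    rw [e]
    refine (measure_union_le _ _).trans ((add_le_add hΦ hL).trans (le_of_eq ?_))
    rw [← ENNReal.ofReal_add (by positivity) (by positivity), add_halves]
  rintro θ ⟨hθΦ, hθL⟩
  simp only [mem_ofPred_eq] at hθΦ hθL
  let p : EuclideanSpace ℝ (Fin 2) → ℝ := fun x => inner ℝ x (eVec θ)
  have hp : ∀ x ∈ F, |p x| < 2 ^ n := fun x hx =>
    (abs_inner_eVec_le x θ).trans_lt (norm_lt_of_mem_shell (hFs x hx))
  let Q : ℕ → Finset (EuclideanSpace ℝ (Fin 2)) := fun k => F.filter fun x => p x ∈ shell ℝ k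
  set I := Finset.Icc (n - J) n with hI
  have hlow : ∀ k ∈ I, ENNReal.ofReal ((∑ x ∈ Q k, w x) ^ 2 / M) ≤
      nuT t k ((fun x => inner ℝ x (eVec θ)) '' E) := by
    intro k hk
    refine sq_div_energy_le_nuT ht (Finset.mem_Icc.1 hk).2 (Finset.filter_subset _ F) hw (p := p)
      (fun x hx => hp x (Finset.mem_filter.1 hx).1) (fun x hx => ?_) hM0 hθΦ
    obtain ⟨hx1, hx2⟩ := Finset.mem_filter.1 hx
    exact ⟨mem_image_of_mem _ (hFE hx1).1, hx2⟩
  have hmass : m / 2 ≤ ∑ k ∈ I, ∑ x ∈ Q k, w x := by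
    have hpt : ∀ x ∈ F, w x ≤ (if θ ∈ A x then w x else 0) +
        ∑ k ∈ I, if p x ∈ shell ℝ k then w x else 0 := by
      intro x hx
      have h0 : ∀ k ∈ I, 0 ≤ if p x ∈ shell ℝ k then w x else 0 := fun k _ => by
        split_ifs
        exacts [hw x, le_rfl]
      by_cases hA : θ ∈ A x
      · rw [if_pos hA]
        linarith [Finset.sum_nonneg h0]
      · have hA' : (2 : ℝ) ^ n / 2 ^ (J + 1) < |p x| := not_le.1 hA
        obtain ⟨k, hk⟩ := exists_mem_shell (p x)
        have hk1 := norm_lt_of_mem_shell hk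
        rw [Real.norm_eq_abs] at hk1
        have hkI : k ∈ I := by
          have h1 : n < k + (J + 1) := by
            have : (2 : ℝ) ^ n < 2 ^ (k + (J + 1)) := by
              rw [pow_add, ← div_lt_iff₀ (by positivity)]
              exact hA'.trans hk1
            exact (pow_lt_pow_iff_right₀ (one_lt_two (α := ℝ))).1 this
          have h2 : k ≤ n := by
            by_cases hk0 : k = 0
            · omega
            have h3 := half_le_norm_of_mem_shell hk0 hk
            rw [Real.norm_eq_abs] at h3
            have : (2 : ℝ) ^ k < 2 ^ (n + 1) := by
              rw [pow_succ]
              linarith [hp x hx]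
            have := (pow_lt_pow_iff_right₀ (one_lt_two (α := ℝ))).1 this
            omega
          exact Finset.mem_Icc.2 ⟨by omega, h2⟩
        rw [if_neg hA, zero_add]
        refine le_trans (le_of_eq ?_) (Finset.single_le_sum h0 hkI)
        rw [if_pos hk]
    have h1 := Finset.sum_le_sum hpt
    rw [Finset.sum_add_distrib, Finset.sum_comm] at h1
    simp only [Q, Finset.sum_filter]
    linarith
  have hcard : (I.card : ℝ) ≤ J + 1 := by
    have : I.card ≤ J + 1 := by rw [hI, Nat.card_Icc]; omega
    exact_mod_cast this
  have hsq : (m / 2) ^ 2 ≤ (J + 1) * ∑ k ∈ I, (∑ x ∈ Q k, w x) ^ 2 := by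
    refine (pow_le_pow_left₀ (by positivity) hmass 2).trans (sq_sum_le_card_mul_sum_sq.trans ?_)
    gcongr
  refine le_trans ?_ (Finset.sum_le_sum hlow)
  rw [← ENNReal.ofReal_sum_of_nonneg fun k _ => by positivity, ← Finset.sum_div]
  refine (mul_le_mul_right hnu _).trans ?_
  rw [← ENNReal.ofReal_mul hc.le]
  refine ENNReal.ofReal_le_ofReal ?_
  have h14 : (0 : ℝ) < 14 ^ s := by positivity
  rw [le_div_iff₀ hM0, hM]
  have hJ1 : (0 : ℝ) < J + 1 := by positivity
  refine le_of_mul_le_mul_left ?_ hJ1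
  refine le_trans (le_of_eq ?_) hsq
  field_simp
  ring

/-- If each event of a sequence has complement of measure at most `δ`, then the weighted sum of
their indicators diverges off a set of measure at most `δ`, for any divergent weights. -/
theorem measure_tsum_indicator_lt_top_le {Ω : Type*} [MeasurableSpace Ω] (μ : Measure Ω)
    [IsFiniteMeasure μ] {G : ℕ → Set Ω} (hG : ∀ n, MeasurableSet (G n)) {δ : ℝ≥0∞}
    (hδ : ∀ n, μ (G n)ᶜ ≤ δ) {a : ℕ → ℝ≥0∞} (ha : ∑' n, a n = ⊤) :
    μ {ω | ∑' n, (G n).indicator (fun _ => a n) ω < ⊤} ≤ δ := by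
  set Y : Ω → ℝ≥0∞ := fun ω => ∑' n, (G n).indicator (fun _ => a n) ω with hY
  have hYm : Measurable Y := Measurable.tsum fun n => measurable_const.indicator (hG n)
  have hmono : Monotone fun N : ℕ => {ω | Y ω ≤ N} := fun N N' h ω hω =>
    le_trans (show Y ω ≤ N from hω) (by exact_mod_cast h)
  have hU : {ω | Y ω < ⊤} = ⋃ N : ℕ, {ω | Y ω ≤ N} := by
    ext ω
    simp only [mem_ofPred_eq, mem_iUnion]
    refine ⟨fun h => ?_, fun ⟨N, hN⟩ => hN.trans_lt (ENNReal.natCast_lt_top N)⟩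
    obtain ⟨N, hN⟩ := ENNReal.exists_nat_gt h.ne
    exact ⟨N, hN.le⟩
  rw [hU, hmono.measure_iUnion]
  refine iSup_le fun N => ?_
  by_contra! hlt
  set B := {ω | Y ω ≤ N}
  have hB : MeasurableSet B := measurableSet_le hYm measurable_const
  have hlow : ∀ n, a n * (μ B - δ) ≤ ∫⁻ ω in B, (G n).indicator (fun _ => a n) ω ∂μ := fun n => by
    rw [lintegral_indicator_const (hG n), Measure.restrict_apply (hG n)]
    gcongr
    rw [tsub_le_iff_right]
    calc μ B ≤ μ (G n ∩ B ∪ (G n)ᶜ) := measure_mono fun ω hω => by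
          by_cases h : ω ∈ G n
          · exact Or.inl ⟨h, hω⟩
          · exact Or.inr h
      _ ≤ μ (G n ∩ B) + μ (G n)ᶜ := measure_union_le _ _
      _ ≤ _ := by gcongr; exact hδ n
  have hup : ∫⁻ ω in B, Y ω ∂μ ≤ N * μ B := by
    rw [← setLIntegral_const]
    exact setLIntegral_mono measurable_const fun ω hω => hω
  have htop : ∫⁻ ω in B, Y ω ∂μ = ⊤ := by
    rw [hY, lintegral_tsum fun n => (measurable_const.indicator (hG n)).aemeasurable]
    refine top_unique (le_trans ?_ (ENNReal.tsum_le_tsum hlow))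
    rw [ENNReal.tsum_mul_right, ha, ENNReal.top_mul (tsub_pos_of_lt hlt).ne']
  rw [htop] at hup
  exact (ENNReal.mul_lt_top (ENNReal.natCast_lt_top N) (measure_lt_top μ B)).not_ge hup

theorem ae_tsum_nuT_proj_eq_top {t s : ℝ} (ht : 0 ≤ t) (hts : t < s) (hs1 : s < 1)
    {E : Set (EuclideanSpace ℝ (Fin 2))} (hE : ∑' n, nuT s n E = ⊤) :
    ∀ᵐ θ ∂angleMeasure, ∑' k, nuT t k ((fun x => inner ℝ x (eVec θ)) '' E) = ⊤ := by
  rw [ae_iff]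
  refine le_antisymm (_root_.le_of_forall_pos_le_add fun ε hε => ?_) bot_le
  rcases eq_or_ne ε ⊤ with rfl | hεt
  · simp
  have hδ : 0 < ε.toReal := ENNReal.toReal_pos hε.ne' hεt
  obtain ⟨J, c, hc, h⟩ := exists_good_angles ht hts hs1 hδ
  choose G hGm hGδ hG using fun n => h E (n + 1) n.succ_ne_zero
  rw [ENNReal.ofReal_toReal hεt] at hGδ
  have hsum : ∑' n, ENNReal.ofReal c * nuT s (n + 1) E = ⊤ := by
    have h1 : ∑' n, nuT s (n + 1) E = ⊤ := by
      rw [tsum_eq_zero_add' ENNReal.summable] at hE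
      exact (ENNReal.add_eq_top.1 hE).resolve_left (nuT_lt_top s 0 E).ne
    rw [ENNReal.tsum_mul_left, h1, ENNReal.mul_top (by simpa using hc)]
  rw [zero_add]
  refine le_trans (measure_mono fun θ hθ => ?_)
    (measure_tsum_indicator_lt_top_le angleMeasure hGm hGδ hsum)
  set ν : ℕ → ℝ≥0∞ := fun k => nuT t k ((fun x => inner ℝ x (eVec θ)) '' E) with hν
  have hνt : ∑' k, ν k < ⊤ := lt_top_iff_ne_top.2 hθ
  calc ∑' n, (G n).indicator (fun _ => ENNReal.ofReal c * nuT s (n + 1) E) θ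
      ≤ ∑' n, ∑' k, if k ∈ Finset.Icc (n + 1 - J) (n + 1) then ν k else 0 := by
        refine ENNReal.tsum_le_tsum fun n => ?_
        rw [tsum_eq_sum (s := Finset.Icc (n + 1 - J) (n + 1)) fun k hk => if_neg hk,
          Finset.sum_congr rfl fun k hk => if_pos hk]
        by_cases hθG : θ ∈ G n
        · rw [indicator_of_mem hθG]
          exact hG n θ hθG
        · rw [indicator_of_notMem hθG]
          exact bot_le
    _ = ∑' k, ∑' n, if k ∈ Finset.Icc (n + 1 - J) (n + 1) then ν k else 0 := ENNReal.tsum_comm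
    _ ≤ ∑' k, ((J + k + 1 - (k - 1) : ℕ) : ℝ≥0∞) * ν k := by
        refine ENNReal.tsum_le_tsum fun k => ?_
        rw [tsum_eq_sum (s := Finset.Icc (k - 1) (J + k)) fun n hn => if_neg fun hk => hn ?_]
        · refine (Finset.sum_le_card_nsmul _ _ (ν k) fun n _ => ?_).trans ?_
          · split_ifs
            exacts [le_rfl, bot_le]
          · rw [nsmul_eq_mul, Nat.card_Icc]
        · rw [Finset.mem_Icc] at hk ⊢
          omega
    _ ≤ ∑' k, ((J + 2 : ℕ) : ℝ≥0∞) * ν k := by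
        refine ENNReal.tsum_le_tsum fun k => ?_
        gcongr
        omega
    _ < ⊤ := by
        rw [ENNReal.tsum_mul_left]
        exact ENNReal.mul_lt_top (ENNReal.natCast_lt_top _) hνt

/-- The projections almost surely have dimension at least `min 1 (macroDim E)`. -/
theorem ae_le_macroDim_proj {d : ℝ} (hd1 : d ≤ 1) {E : Set (EuclideanSpace ℝ (Fin 2))}
    (hd : d ≤ macroDim E) :
    ∀ᵐ θ ∂angleMeasure, d ≤ macroDim ((fun x => inner ℝ x (eVec θ)) '' E) := by
  have h : ∀ q : ℚ, 0 ≤ (q : ℝ) → (q : ℝ) < d →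
      ∀ᵐ θ ∂angleMeasure, (q : ℝ) ≤ macroDim ((fun x => inner ℝ x (eVec θ)) '' E) := by
    intro q hq0 hqd
    obtain ⟨s, hqs, hsd⟩ := exists_between hqd
    have htop := tsum_nuT_eq_top_of_lt (hq0.trans hqs.le) (hsd.trans_le hd)
    filter_upwards [ae_tsum_nuT_proj_eq_top hq0 hqs (hsd.trans_le hd1) htop] with θ hθ
    exact le_macroDim ⟨two_pos.le, tsum_nuT_real_lt_top one_lt_two _⟩ hθ
  simp only [← ae_all_iff] at h
  filter_upwards [h] with θ hθ
  refine le_of_forall_lt fun u hu => ?_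
  rcases lt_or_ge u 0 with hu0 | hu0
  · exact hu0.trans_le (macroDim_nonneg _)
  · obtain ⟨q, huq, hqd⟩ := exists_rat_btwn hu
    exact huq.trans_le (hθ q (hu0.trans huq.le) hqd)

theorem macroDim_real_le_one (T : Set ℝ) : macroDim T ≤ 1 :=
  le_of_forall_gt_imp_ge_of_dense fun s hs =>
    macroDim_le (by linarith : (0 : ℝ) ≤ s) (tsum_nuT_real_lt_top hs T)

/-- The projections almost surely do not increase a dimension below one. -/
theorem ae_macroDim_proj_le {E : Set (EuclideanSpace ℝ (Fin 2))} (hd : macroDim E < 1) :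
    ∀ᵐ θ ∂angleMeasure, macroDim ((fun x => inner ℝ x (eVec θ)) '' E) ≤ macroDim E := by
  have h : ∀ q : ℚ, macroDim E < q → (q : ℝ) < 1 →
      ∀ᵐ θ ∂angleMeasure, macroDim ((fun x => inner ℝ x (eVec θ)) '' E) ≤ q := by
    intro q hdq hq1
    have hq0 : (0 : ℝ) ≤ q := (macroDim_nonneg E).trans hdq.le
    have hlt := tsum_nuT_lt_top_of_macroDim_lt
      ⟨three_pos.le, tsum_nuT_plane_lt_top (by norm_num : (2 : ℝ) < 3) E⟩ hdq
    filter_upwards [ae_tsum_nuT_proj_lt_top hq0 hq1 hlt] with θ hθ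
    exact macroDim_le hq0 hθ
  simp only [← ae_all_iff] at h
  filter_upwards [h] with θ hθ
  refine le_of_forall_gt fun u hu => ?_
  obtain ⟨q, hdq, hqu⟩ := exists_rat_btwn (lt_min hu hd)
  exact (hθ q hdq (hqu.trans_le (min_le_right _ _))).trans_lt (hqu.trans_le (min_le_left _ _))

open RealInnerProductSpace in
/-- Marstrand-type projection theorem for the macroscopic Hausdorff dimension. -/
theorem stmt18 (E : Set (EuclideanSpace ℝ (Fin 2))) (hE : MeasurableSet E) :
    (macroDim E < 1 →
      ∀ᵐ θ ∂(volume.restrict (Set.Icc (0:ℝ) Real.pi)),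
        macroDim ((fun x => ⟪x, eVec θ⟫) '' E) = macroDim E) ∧
    (1 ≤ macroDim E →
      ∀ᵐ θ ∂(volume.restrict (Set.Icc (0:ℝ) Real.pi)),
        macroDim ((fun x => ⟪x, eVec θ⟫) '' E) = 1) := by
  refine ⟨fun h => ?_, fun h => ?_⟩
  · filter_upwards [ae_macroDim_proj_le h, ae_le_macroDim_proj h.le le_rfl] with θ h1 h2
    exact le_antisymm h1 h2
  · filter_upwards [ae_le_macroDim_proj le_rfl h] with θ hθ
    exact le_antisymm (macroDim_real_le_one _) hθ
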